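/- Let k be a field, S = k[x_1,...,x_n], and let Q be a subspace of the space of linear forms with quotient projection π : S → S/(Q) (where S/(Q) is again a polynomial ring). Let f ∈ S be a homogeneous cubic such that every P ∈ P_f contains a fixed nonzero linear form ℓ, with Q = ⟨ℓ⟩. Then dim L_f = 1 + dim L_{f̄}, where f̄ = π(f) is the reduced cubic in S/(ℓ). -/

import Mathlib

open MvPolynomial

/-- The slice rank of a polynomial: minimal `r` such that `f` lies in an ideal
generated by `r` linear forms. -/
noncomputable def sliceRank {k : Type*} [Field k] {σ : Type*} (f : MvPolynomial σ k) : ℕ :=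
  sInf {r : ℕ | ∃ ℓ : Fin r → MvPolynomial σ k,
    (∀ i, (ℓ i).IsHomogeneous 1) ∧ f ∈ Ideal.span (Set.range ℓ)}

/-- `P_f`: the set of subspaces of linear forms of dimension `rk f` whose ideal contains `f`. -/
def slicePlanes {k : Type*} [Field k] {σ : Type*} (f : MvPolynomial σ k) :
    Set (Submodule k (MvPolynomial σ k)) :=
  {P | P ≤ homogeneousSubmodule σ k 1 ∧ Module.finrank k P = sliceRank f ∧
    f ∈ Ideal.span (P : Set (MvPolynomial σ k))}

/-- `L_f`: the sum of all subspaces in `P_f`. -/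
noncomputable def Lspace {k : Type*} [Field k] {σ : Type*} (f : MvPolynomial σ k) :
    Submodule k (MvPolynomial σ k) :=
  sSup (slicePlanes f)

section LinearForms

variable {k : Type*} [Field k]

section Homogeneous

variable {σ τ : Type*}

lemma finite_of_le_linearForms [Finite σ] {P : Submodule k (MvPolynomial σ k)}
    (hP : P ≤ homogeneousSubmodule σ k 1) : Module.Finite k P := by
  have : Module.Finite k (homogeneousSubmodule σ k 1) :=
    Module.Finite.iff_fg.mpr (homogeneousSubmodule_fg σ k 1)
  exact Submodule.finiteDimensional_of_le hP

lemma exists_smul_eq_of_mem_span_singleton {p ℓ : MvPolynomial σ k} {d : ℕ}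
    (hp : p.IsHomogeneous d) (hℓ : ℓ.IsHomogeneous d) (h : p ∈ Ideal.span {ℓ}) :
    ∃ c : k, p = c • ℓ := by
  obtain ⟨q, rfl⟩ := Ideal.mem_span_singleton'.mp h
  by_cases h0 : q * ℓ = 0
  · exact ⟨0, by simp [h0]⟩
  have hq : q ≠ 0 := left_ne_zero_of_mul h0
  have hl : ℓ ≠ 0 := right_ne_zero_of_mul h0
  have hdeg := totalDegree_mul_of_isDomain hq hl
  rw [hp.totalDegree h0, hℓ.totalDegree hl] at hdeg
  refine ⟨coeff 0 q, ?_⟩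
  rw [smul_eq_C_mul, ← totalDegree_eq_zero_iff_eq_C.mp (by omega)]

lemma isHomogeneous_algHom {π : MvPolynomial σ k →ₐ[k] MvPolynomial τ k}
    (hπ : ∀ p : MvPolynomial σ k, p.IsHomogeneous 1 → (π p).IsHomogeneous 1)
    {p : MvPolynomial σ k} {d : ℕ} (hp : p.IsHomogeneous d) : (π p).IsHomogeneous d := by
  rw [MvPolynomial.aeval_unique π, ← one_mul d]
  exact hp.aeval (π ∘ X) (fun i => hπ _ (isHomogeneous_X k i))

lemma homogeneousComponent_algHom {π : MvPolynomial σ k →ₐ[k] MvPolynomial τ k}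
    (hπ : ∀ p : MvPolynomial σ k, p.IsHomogeneous 1 → (π p).IsHomogeneous 1)
    (d : ℕ) (p : MvPolynomial σ k) :
    homogeneousComponent d (π p) = π (homogeneousComponent d p) := by
  have h : ∀ i, homogeneousComponent d (π (homogeneousComponent i p)) =
      if i = d then π (homogeneousComponent i p) else 0 := fun i => by
    have := homogeneousComponent_of_mem (n := i) (m := d)
      (isHomogeneous_algHom hπ (homogeneousComponent_isHomogeneous i p))
    simpa [eq_comm] using this
  conv_lhs => rw [← sum_homogeneousComponent p]
  simp only [map_sum, h, Finset.sum_ite_eq', Finset.mem_range]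
  split_ifs with hd
  · rfl
  · rw [homogeneousComponent_eq_zero d p (by omega), map_zero]

lemma linearForms_le_map_algHom {π : MvPolynomial σ k →ₐ[k] MvPolynomial τ k}
    (hπ : ∀ p : MvPolynomial σ k, p.IsHomogeneous 1 → (π p).IsHomogeneous 1)
    (hsurj : Function.Surjective π) :
    homogeneousSubmodule τ k 1 ≤ (homogeneousSubmodule σ k 1).map π.toLinearMap := by
  intro w hw
  obtain ⟨p, rfl⟩ := hsurj w
  refine ⟨homogeneousComponent 1 p, homogeneousComponent_isHomogeneous 1 p, ?_⟩
  simp only [AlgHom.toLinearMap_apply]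
  rw [← homogeneousComponent_algHom hπ]
  exact homogeneousComponent_eq_self hw

end Homogeneous

section SliceRank

variable {σ : Type*}

lemma exists_linearForms_of_mem_span [Finite σ] {f : MvPolynomial σ k}
    {P : Submodule k (MvPolynomial σ k)} (hP : P ≤ homogeneousSubmodule σ k 1)
    (hf : f ∈ Ideal.span (P : Set (MvPolynomial σ k))) :
    ∃ ℓ : Fin (Module.finrank k P) → MvPolynomial σ k,
      (∀ i, (ℓ i).IsHomogeneous 1) ∧ f ∈ Ideal.span (Set.range ℓ) := by
  have := finite_of_le_linearForms hP
  let b := Module.finBasis k P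
  refine ⟨fun i => (b i : MvPolynomial σ k), fun i => hP (b i).2, ?_⟩
  refine Ideal.span_le.mpr (fun x hx => ?_) hf
  have hx' : x = ∑ i, b.repr ⟨x, hx⟩ i • (b i : MvPolynomial σ k) := by
    have h := congrArg P.subtype (b.sum_repr ⟨x, hx⟩)
    rw [map_sum] at h
    exact h.symm
  rw [hx', SetLike.mem_coe]
  refine Ideal.sum_mem _ fun i _ => ?_
  rw [smul_eq_C_mul]
  exact Ideal.mul_mem_left _ _ (Ideal.subset_span ⟨i, rfl⟩)

lemma sliceRank_le_finrank [Finite σ] {f : MvPolynomial σ k}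
    {P : Submodule k (MvPolynomial σ k)} (hP : P ≤ homogeneousSubmodule σ k 1)
    (hf : f ∈ Ideal.span (P : Set (MvPolynomial σ k))) : sliceRank f ≤ Module.finrank k P :=
  Nat.sInf_le (exists_linearForms_of_mem_span hP hf)

lemma slicePlanes_nonempty [Finite σ] {f : MvPolynomial σ k}
    {P : Submodule k (MvPolynomial σ k)} (hP : P ≤ homogeneousSubmodule σ k 1)
    (hf : f ∈ Ideal.span (P : Set (MvPolynomial σ k))) : (slicePlanes f).Nonempty := by
  have hne : {r : ℕ | ∃ ℓ : Fin r → MvPolynomial σ k,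
      (∀ i, (ℓ i).IsHomogeneous 1) ∧ f ∈ Ideal.span (Set.range ℓ)}.Nonempty :=
    ⟨_, exists_linearForms_of_mem_span hP hf⟩
  obtain ⟨ℓ, hℓ, hfℓ⟩ := Nat.sInf_mem hne
  have hle : Submodule.span k (Set.range ℓ) ≤ homogeneousSubmodule σ k 1 :=
    Submodule.span_le.mpr (Set.range_subset_iff.mpr hℓ)
  have hmem : f ∈ Ideal.span (Submodule.span k (Set.range ℓ) : Set (MvPolynomial σ k)) :=
    Ideal.span_mono Submodule.subset_span hfℓ
  refine ⟨_, hle, le_antisymm ?_ (sliceRank_le_finrank hle hmem), hmem⟩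
  exact (finrank_range_le_card ℓ).trans_eq (Fintype.card_fin _)

lemma mem_span_linearForms_of_isHomogeneous {f : MvPolynomial σ k} {d : ℕ} (hd : d ≠ 0)
    (hf : f.IsHomogeneous d) :
    f ∈ Ideal.span (homogeneousSubmodule σ k 1 : Set (MvPolynomial σ k)) := by
  have hX : f ∈ Ideal.span (X '' (Set.univ : Set σ) : Set (MvPolynomial σ k)) := by
    refine mem_ideal_span_X_image.mpr fun m hm => ?_
    by_contra! h
    have hm0 : m = 0 := Finsupp.ext fun i => h i (Set.mem_univ i)
    refine hd ?_
    rw [← hf (mem_support_iff.mp hm), hm0, map_zero]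
  refine Ideal.span_mono ?_ hX
  rintro _ ⟨i, -, rfl⟩
  exact isHomogeneous_X k i

lemma Lspace_le_linearForms (f : MvPolynomial σ k) :
    Lspace f ≤ homogeneousSubmodule σ k 1 :=
  sSup_le fun _ hP => hP.1

end SliceRank

section Quotient

variable {n m : ℕ} {ℓ : MvPolynomial (Fin n) k}
  {π : MvPolynomial (Fin n) k →ₐ[k] MvPolynomial (Fin m) k}

lemma finrank_eq_one_add_finrank_map (hℓhom : ℓ.IsHomogeneous 1) (hℓ0 : ℓ ≠ 0)
    (hπker : RingHom.ker π = Ideal.span {ℓ}) {P : Submodule k (MvPolynomial (Fin n) k)}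
    (hP : P ≤ homogeneousSubmodule (Fin n) k 1) (hℓP : ℓ ∈ P) :
    Module.finrank k P = 1 + Module.finrank k (P.map π.toLinearMap) := by
  have := finite_of_le_linearForms hP
  have hℓker : π ℓ = 0 := by
    rw [← RingHom.mem_ker, hπker]; exact Ideal.mem_span_singleton_self ℓ
  have hker : LinearMap.ker (π.toLinearMap.domRestrict P) = Submodule.span k {⟨ℓ, hℓP⟩} := by
    ext ⟨x, hx⟩
    simp only [LinearMap.mem_ker, LinearMap.domRestrict_apply, AlgHom.toLinearMap_apply,
      Submodule.mem_span_singleton, Subtype.ext_iff, Submodule.coe_smul]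
    constructor
    · intro h
      obtain ⟨c, hc⟩ := exists_smul_eq_of_mem_span_singleton (hP hx) hℓhom
        (hπker ▸ (RingHom.mem_ker).mpr h)
      exact ⟨c, hc.symm⟩
    · rintro ⟨c, rfl⟩
      rw [map_smul, hℓker, smul_zero]
  have h := LinearMap.finrank_range_add_finrank_ker (π.toLinearMap.domRestrict P)
  rw [hker, finrank_span_singleton (by simpa [Subtype.ext_iff] using hℓ0),
    LinearMap.range_domRestrict] at h
  omega

lemma map_mem_span_map {f : MvPolynomial (Fin n) k} {P : Submodule k (MvPolynomial (Fin n) k)}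
    (hf : f ∈ Ideal.span (P : Set (MvPolynomial (Fin n) k))) :
    π f ∈ Ideal.span (P.map π.toLinearMap : Set (MvPolynomial (Fin m) k)) := by
  have h := Ideal.mem_map_of_mem π hf
  rwa [Ideal.map_span] at h

lemma map_linearForms_le
    (hπdeg : ∀ p : MvPolynomial (Fin n) k, p.IsHomogeneous 1 → (π p).IsHomogeneous 1)
    {P : Submodule k (MvPolynomial (Fin n) k)} (hP : P ≤ homogeneousSubmodule (Fin n) k 1) :
    P.map π.toLinearMap ≤ homogeneousSubmodule (Fin m) k 1 := by
  rintro _ ⟨p, hp, rfl⟩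
  exact hπdeg p (hP hp)

/-- Every space of linear forms downstairs whose ideal contains `π f` is the image of a space of
linear forms containing `ℓ` whose ideal contains `f`. -/
lemma exists_lift_of_mem_span (hℓhom : ℓ.IsHomogeneous 1)
    (hπsurj : Function.Surjective π) (hπker : RingHom.ker π = Ideal.span {ℓ})
    (hπdeg : ∀ p : MvPolynomial (Fin n) k, p.IsHomogeneous 1 → (π p).IsHomogeneous 1)
    {f : MvPolynomial (Fin n) k} {R : Submodule k (MvPolynomial (Fin m) k)}
    (hR : R ≤ homogeneousSubmodule (Fin m) k 1)
    (hf : π f ∈ Ideal.span (R : Set (MvPolynomial (Fin m) k))) :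
    ∃ P : Submodule k (MvPolynomial (Fin n) k), P ≤ homogeneousSubmodule (Fin n) k 1 ∧ ℓ ∈ P ∧
      P.map π.toLinearMap = R ∧ f ∈ Ideal.span (P : Set (MvPolynomial (Fin n) k)) := by
  have hℓker : π ℓ = 0 := by
    rw [← RingHom.mem_ker, hπker]; exact Ideal.mem_span_singleton_self ℓ
  set P := R.comap π.toLinearMap ⊓ homogeneousSubmodule (Fin n) k 1
  have hℓP : ℓ ∈ P := ⟨by simp [hℓker], hℓhom⟩
  have hmap : P.map π.toLinearMap = R := by
    refine le_antisymm (Submodule.map_le_iff_le_comap.mpr inf_le_left) fun w hw => ?_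
    obtain ⟨p, hp, rfl⟩ := linearForms_le_map_algHom hπdeg hπsurj (hR hw)
    exact ⟨p, ⟨hw, hp⟩, rfl⟩
  refine ⟨P, inf_le_right, hℓP, hmap, ?_⟩
  have hspan : Ideal.span (R : Set (MvPolynomial (Fin m) k)) =
      (Ideal.span (P : Set (MvPolynomial (Fin n) k))).map π := by
    rw [Ideal.map_span, ← hmap]; rfl
  rw [hspan, Ideal.mem_map_iff_of_surjective π hπsurj] at hf
  obtain ⟨g, hg, hgf⟩ := hf
  have hsub : f - g ∈ Ideal.span {ℓ} := by
    rw [← hπker, RingHom.mem_ker, map_sub, hgf, sub_self]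
  have := Ideal.add_mem _ (Ideal.span_mono (Set.singleton_subset_iff.mpr hℓP) hsub) hg
  simpa using this

end Quotient

end LinearForms

/-- Let `ℓ` be a nonzero linear form of `S = k[x_1,…,x_n]` and let
`π : S → S/(ℓ)` be the projection onto the quotient, which is again a polynomial ring
(realized as a degree-preserving surjective `k`-algebra homomorphism onto
`k[x_1,…,x_m]` with kernel `(ℓ)`). If `f` is a homogeneous cubic such that every
`P ∈ P_f` contains `ℓ`, then `dim L_f = 1 + dim L_{f̄}` where `f̄ = π f`. -/
theorem dim_Lspace_eq_one_add_of_common_linear_form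
    {k : Type*} [Field k] {n m : ℕ}
    (ℓ : MvPolynomial (Fin n) k) (hℓhom : ℓ.IsHomogeneous 1) (hℓ0 : ℓ ≠ 0)
    (π : MvPolynomial (Fin n) k →ₐ[k] MvPolynomial (Fin m) k)
    (hπsurj : Function.Surjective π)
    (hπker : RingHom.ker π = Ideal.span {ℓ})
    (hπdeg : ∀ p : MvPolynomial (Fin n) k, p.IsHomogeneous 1 → (π p).IsHomogeneous 1)
    (f : MvPolynomial (Fin n) k) (hf : f.IsHomogeneous 3)
    (hmem : ∀ P ∈ slicePlanes f, ℓ ∈ P) :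
    Module.finrank k (Lspace f) = 1 + Module.finrank k (Lspace (π f)) := by
  obtain ⟨P₀, hP₀⟩ := slicePlanes_nonempty le_rfl
    (mem_span_linearForms_of_isHomogeneous three_ne_zero hf)
  have hdim : ∀ {P : Submodule k (MvPolynomial (Fin n) k)},
      P ≤ homogeneousSubmodule (Fin n) k 1 → ℓ ∈ P →
      Module.finrank k P = 1 + Module.finrank k (P.map π.toLinearMap) :=
    finrank_eq_one_add_finrank_map hℓhom hℓ0 hπker
  have hrank : sliceRank f = 1 + sliceRank (π f) := by
    refine le_antisymm ?_ ?_
    · obtain ⟨R, hR, hRdim, hfR⟩ := slicePlanes_nonempty (map_linearForms_le hπdeg hP₀.1)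
        (map_mem_span_map hP₀.2.2)
      obtain ⟨P, hP, hℓP, rfl, hfP⟩ :=
        exists_lift_of_mem_span hℓhom hπsurj hπker hπdeg hR hfR
      rw [← hRdim, ← hdim hP hℓP]
      exact sliceRank_le_finrank hP hfP
    · rw [← hP₀.2.1, hdim hP₀.1 (hmem P₀ hP₀)]
      exact Nat.add_le_add_left (sliceRank_le_finrank (map_linearForms_le hπdeg hP₀.1)
        (map_mem_span_map hP₀.2.2)) 1
  have hmap : (Lspace f).map π.toLinearMap = Lspace (π f) := by
    refine le_antisymm (Submodule.map_le_iff_le_comap.mpr (sSup_le fun P hP => ?_))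
      (sSup_le fun R hR => ?_)
    · refine Submodule.map_le_iff_le_comap.mp (le_sSup ⟨map_linearForms_le hπdeg hP.1, ?_,
        map_mem_span_map hP.2.2⟩)
      have h := hdim hP.1 (hmem P hP)
      have h' := hP.2.1
      omega
    · obtain ⟨P, hP, hℓP, rfl, hfP⟩ :=
        exists_lift_of_mem_span hℓhom hπsurj hπker hπdeg hR.1 hR.2.2
      refine Submodule.map_mono (le_sSup ⟨hP, ?_, hfP⟩)
      rw [hdim hP hℓP, hR.2.1, hrank]
  rw [hdim (Lspace_le_linearForms f) (le_sSup hP₀ (hmem P₀ hP₀)), hmap]
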